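/- Outer bound with no backward cross-link (36): For the deterministic two-hop interference channel with parameters (n, m, f, n̄, m̄) with m̄ = 0, the sum capacity satisfies C_sum ≤ f + max(n − m, m) + (n̄ − f)⁺. -/

import Mathlib

open scoped Classical

namespace TwoHopIC

/-- The `q × q` lower-shift matrix `S^k` over `F₂`, with `(S^k)_{i,j} = 1` iff `i = j + k`. -/
def shiftMat (q k : ℕ) : Matrix (Fin q) (Fin q) (ZMod 2) :=
  Matrix.of fun i j => if (i : ℕ) = (j : ℕ) + k then 1 else 0

/-- Forward (first-hop) signal alphabet: vectors in `F₂^q` with `q = max m n`. -/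
abbrev FSig (n m : ℕ) := Fin (max m n) → ZMod 2

/-- Backward/second-hop signal alphabet: vectors in `F₂^q̄` with `q̄ = max(m̄, n̄, f)`. -/
abbrev BSig (f nb mb : ℕ) := Fin (max mb (max nb f)) → ZMod 2

/-- A blocklength-`N` code with message sets of sizes `M1`, `M2`:
causal encoders at the sources (using the messages and the overheard signals),
causal encoders at the relays (using their received signals), and decoders at the
destinations (using the `N` received signals). -/
structure Code (n m f nb mb N M1 M2 : ℕ) where
  encS1 : (t : ℕ) → Fin M1 → (Fin t → BSig f nb mb) → FSig n m
  encS2 : (t : ℕ) → Fin M2 → (Fin t → BSig f nb mb) → FSig n m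
  encR1 : (t : ℕ) → (Fin t → FSig n m) → BSig f nb mb
  encR2 : (t : ℕ) → (Fin t → FSig n m) → BSig f nb mb
  dec1 : (Fin N → BSig f nb mb) → Fin M1
  dec2 : (Fin N → BSig f nb mb) → Fin M2

variable {n m f nb mb N M1 M2 : ℕ}

/-- Given a history `h` of source signals `(X_{S1}[·], X_{S2}[·])`, the signal received by
relay 1 at time `s`: `Y_{R1}[s] = S^{q-n} X_{S1}[s] ⊕ S^{q-m} X_{S2}[s]`. -/
def relayRx1 (n m : ℕ) {t : ℕ} (h : Fin t → FSig n m × FSig n m) (s : Fin t) : FSig n m :=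
  (shiftMat (max m n) (max m n - n)).mulVec (h s).1 +
  (shiftMat (max m n) (max m n - m)).mulVec (h s).2

/-- `Y_{R2}[s] = S^{q-m} X_{S1}[s] ⊕ S^{q-n} X_{S2}[s]`. -/
def relayRx2 (n m : ℕ) {t : ℕ} (h : Fin t → FSig n m × FSig n m) (s : Fin t) : FSig n m :=
  (shiftMat (max m n) (max m n - m)).mulVec (h s).1 +
  (shiftMat (max m n) (max m n - n)).mulVec (h s).2

/-- Relay 1 transmitted signal `X_{R1}[s]`, a causal function of `Y_{R1}[1..s-1]`. -/
def relayTx1 (C : Code n m f nb mb N M1 M2) {t : ℕ}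
    (h : Fin t → FSig n m × FSig n m) (s : Fin t) : BSig f nb mb :=
  C.encR1 s.val (fun u => relayRx1 n m h ⟨u.val, lt_trans u.isLt s.isLt⟩)

/-- Relay 2 transmitted signal `X_{R2}[s]`, a causal function of `Y_{R2}[1..s-1]`. -/
def relayTx2 (C : Code n m f nb mb N M1 M2) {t : ℕ}
    (h : Fin t → FSig n m × FSig n m) (s : Fin t) : BSig f nb mb :=
  C.encR2 s.val (fun u => relayRx2 n m h ⟨u.val, lt_trans u.isLt s.isLt⟩)

/-- Source 1 overheard signal `Y_{S1}[s] = S^{q̄-n̄} X_{R1}[s] ⊕ S^{q̄-m̄} X_{R2}[s]`. -/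
def srcRx1 (C : Code n m f nb mb N M1 M2) {t : ℕ}
    (h : Fin t → FSig n m × FSig n m) (s : Fin t) : BSig f nb mb :=
  (shiftMat (max mb (max nb f)) (max mb (max nb f) - nb)).mulVec (relayTx1 C h s) +
  (shiftMat (max mb (max nb f)) (max mb (max nb f) - mb)).mulVec (relayTx2 C h s)

/-- Source 2 overheard signal `Y_{S2}[s] = S^{q̄-n̄} X_{R2}[s] ⊕ S^{q̄-m̄} X_{R1}[s]`. -/
def srcRx2 (C : Code n m f nb mb N M1 M2) {t : ℕ}
    (h : Fin t → FSig n m × FSig n m) (s : Fin t) : BSig f nb mb :=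
  (shiftMat (max mb (max nb f)) (max mb (max nb f) - nb)).mulVec (relayTx2 C h s) +
  (shiftMat (max mb (max nb f)) (max mb (max nb f) - mb)).mulVec (relayTx1 C h s)

/-- The history `(X_{S1}[1..t], X_{S2}[1..t])` of source signals determined by the
messages `(w1, w2)`: at each time the sources apply their causal encoders to their
message and the overheard signals so far. -/
def srcHist (C : Code n m f nb mb N M1 M2) (w1 : Fin M1) (w2 : Fin M2) :
    (t : ℕ) → Fin t → FSig n m × FSig n m
  | 0 => fun i => i.elim0
  | t + 1 =>
    Fin.snoc (srcHist C w1 w2 t)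
      (C.encS1 t w1 (srcRx1 C (srcHist C w1 w2 t)),
       C.encS2 t w2 (srcRx2 C (srcHist C w1 w2 t)))

/-- `(X_{S1}[t], X_{S2}[t])`. -/
def srcXat (C : Code n m f nb mb N M1 M2) (w1 : Fin M1) (w2 : Fin M2) (t : ℕ) :
    FSig n m × FSig n m :=
  srcHist C w1 w2 (t + 1) (Fin.last t)

/-- `Y_{R1}[t]`. -/
def relayRxAt1 (C : Code n m f nb mb N M1 M2) (w1 : Fin M1) (w2 : Fin M2) (t : ℕ) :
    FSig n m :=
  relayRx1 n m (srcHist C w1 w2 (t + 1)) (Fin.last t)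

/-- `Y_{R2}[t]`. -/
def relayRxAt2 (C : Code n m f nb mb N M1 M2) (w1 : Fin M1) (w2 : Fin M2) (t : ℕ) :
    FSig n m :=
  relayRx2 n m (srcHist C w1 w2 (t + 1)) (Fin.last t)

/-- `X_{R1}[t]`. -/
def relayTxAt1 (C : Code n m f nb mb N M1 M2) (w1 : Fin M1) (w2 : Fin M2) (t : ℕ) :
    BSig f nb mb :=
  relayTx1 C (srcHist C w1 w2 (t + 1)) (Fin.last t)

/-- `X_{R2}[t]`. -/
def relayTxAt2 (C : Code n m f nb mb N M1 M2) (w1 : Fin M1) (w2 : Fin M2) (t : ℕ) :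
    BSig f nb mb :=
  relayTx2 C (srcHist C w1 w2 (t + 1)) (Fin.last t)

/-- `Y_{D1}[t] = S^{q̄-f} X_{R1}[t]`. -/
def destRx1 (C : Code n m f nb mb N M1 M2) (w1 : Fin M1) (w2 : Fin M2) (t : ℕ) :
    BSig f nb mb :=
  (shiftMat (max mb (max nb f)) (max mb (max nb f) - f)).mulVec (relayTxAt1 C w1 w2 t)

/-- `Y_{D2}[t] = S^{q̄-f} X_{R2}[t]`. -/
def destRx2 (C : Code n m f nb mb N M1 M2) (w1 : Fin M1) (w2 : Fin M2) (t : ℕ) :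
    BSig f nb mb :=
  (shiftMat (max mb (max nb f)) (max mb (max nb f) - f)).mulVec (relayTxAt2 C w1 w2 t)

/-- Probability of decoding error under independent uniform messages: since the channel is
deterministic, this is the fraction of message pairs `(w1, w2)` on which some decoder errs. -/
noncomputable def errProb (C : Code n m f nb mb N M1 M2) : ℝ :=
  ((Finset.univ.filter fun w : Fin M1 × Fin M2 =>
      C.dec1 (fun t => destRx1 C w.1 w.2 t.val) ≠ w.1 ∨
      C.dec2 (fun t => destRx2 C w.1 w.2 t.val) ≠ w.2).card : ℝ) / ((M1 : ℝ) * (M2 : ℝ))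

/-- A nonnegative rate pair `(R1, R2)` is achievable if for every `ε > 0` there is a
blocklength `N ≥ 1` and a code with message sets of sizes `⌈2^(N R1)⌉`, `⌈2^(N R2)⌉`
whose probability of error is at most `ε`. -/
def Achievable (n m f nb mb : ℕ) (R1 R2 : ℝ) : Prop :=
  0 ≤ R1 ∧ 0 ≤ R2 ∧
    ∀ ε : ℝ, 0 < ε →
      ∃ N : ℕ, 0 < N ∧
        ∃ C : Code n m f nb mb N ⌈(2 : ℝ) ^ ((N : ℝ) * R1)⌉₊ ⌈(2 : ℝ) ^ ((N : ℝ) * R2)⌉₊,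
          errProb C ≤ ε

/-- The sum capacity `C_sum = sup { R1 + R2 : (R1, R2) achievable }`. -/
noncomputable def sumCapacity (n m f nb mb : ℕ) : ℝ :=
  sSup {r : ℝ | ∃ R1 R2 : ℝ, Achievable n m f nb mb R1 R2 ∧ r = R1 + R2}

/-! ### Fibre counting: entropy inequalities for functions on a finite set -/

section FiberCounting

variable {Ω α β γ : Type*} [Fintype Ω]

/-- The number of points of `Ω` on which `X` takes the same value as at `ω`. -/
noncomputable def fiberCard (X : Ω → α) (ω : Ω) : ℝ :=
  ((Finset.univ.filter fun ω' => X ω' = X ω).card : ℝ)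

/-- The sum of the logarithms of the fibre sizes of `X`. If `Ω` carries the uniform probability,
the Shannon entropy of `X` is `log |Ω| - logFiberSum X / |Ω|`. -/
noncomputable def logFiberSum (X : Ω → α) : ℝ :=
  ∑ ω, Real.log (fiberCard X ω)

lemma fiberCard_pos (X : Ω → α) (ω : Ω) : 0 < fiberCard X ω := by
  unfold fiberCard
  exact_mod_cast Finset.card_pos.mpr ⟨ω, by simp⟩

lemma fiberCard_eq_sum [DecidableEq α] (X : Ω → α) (ω : Ω) :
    fiberCard X ω = ∑ ω', if X ω' = X ω then (1 : ℝ) else 0 := by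
  rw [Finset.sum_boole, fiberCard]
  congr!

lemma fiberCard_congr (X : Ω → α) {ω ω' : Ω} (h : X ω = X ω') :
    fiberCard X ω = fiberCard X ω' := by
  simp only [fiberCard, h]

lemma fiberCard_le_of_determines (X : Ω → α) (Y : Ω → β)
    (h : ∀ ω ω', X ω = X ω' → Y ω = Y ω') (ω : Ω) : fiberCard X ω ≤ fiberCard Y ω := by
  unfold fiberCard
  exact_mod_cast Finset.card_le_card fun ω' hω' => by
    simp only [Finset.mem_filter, Finset.mem_univ, true_and] at hω' ⊢
    exact h _ _ hω'

/-- If `X` determines `Y`, then the fibres of `X` are smaller than those of `Y`. -/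
lemma logFiberSum_le_of_determines (X : Ω → α) (Y : Ω → β)
    (h : ∀ ω ω', X ω = X ω' → Y ω = Y ω') : logFiberSum X ≤ logFiberSum Y :=
  Finset.sum_le_sum fun ω _ =>
    Real.log_le_log (fiberCard_pos X ω) (fiberCard_le_of_determines X Y h ω)

lemma logFiberSum_of_injective (X : Ω → α) (h : Function.Injective X) :
    logFiberSum X = 0 := by
  refine Finset.sum_eq_zero fun ω _ => ?_
  have hone : fiberCard X ω = 1 := by
    simp only [fiberCard, h.eq_iff, Nat.cast_eq_one, Finset.card_eq_one]
    exact ⟨ω, by ext; simp⟩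
  rw [hone, Real.log_one]

lemma sum_inv_fiberCard_le_one [DecidableEq α] (X : Ω → α) (x : α) :
    ∑ ω, (if X ω = x then (fiberCard X ω)⁻¹ else 0) ≤ 1 := by
  have h : ∀ ω, (if X ω = x then (fiberCard X ω)⁻¹ else 0)
      = if X ω = x then ((Finset.univ.filter fun ω' => X ω' = x).card : ℝ)⁻¹ else 0 := by
    intro ω
    split_ifs with hω
    · simp only [fiberCard, hω]
    · rfl
  rw [Finset.sum_congr rfl fun ω _ => h ω, ← Finset.sum_filter, Finset.sum_const, nsmul_eq_mul]
  exact mul_inv_le_one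

lemma sum_log_le_zero_of_sum_le_card (r : Ω → ℝ) (hr : ∀ ω, 0 < r ω)
    (h : ∑ ω, r ω ≤ Fintype.card Ω) : ∑ ω, Real.log (r ω) ≤ 0 := by
  calc ∑ ω, Real.log (r ω) ≤ ∑ ω, (r ω - 1) :=
        Finset.sum_le_sum fun ω _ => Real.log_le_sub_one_of_pos (hr ω)
    _ ≤ 0 := by simpa using h

/-- Submodularity of entropy, `H(X, Z) + H(V) ≤ H(V, Z) + H(X)` if `X` determines `V`. -/
lemma logFiberSum_submodular (X : Ω → α) (V : Ω → β) (Z : Ω → γ)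
    (hXV : ∀ ω ω', X ω = X ω' → V ω = V ω') :
    logFiberSum (fun ω => (V ω, Z ω)) + logFiberSum X
      ≤ logFiberSum (fun ω => (X ω, Z ω)) + logFiberSum V := by
  set VZ : Ω → β × γ := fun ω => (V ω, Z ω) with hVZ
  set XZ : Ω → α × γ := fun ω => (X ω, Z ω) with hXZ
  have key : ∑ ω, fiberCard VZ ω * fiberCard X ω * (fiberCard XZ ω)⁻¹ * (fiberCard V ω)⁻¹
      ≤ Fintype.card Ω := by
    calc ∑ ω, fiberCard VZ ω * fiberCard X ω * (fiberCard XZ ω)⁻¹ * (fiberCard V ω)⁻¹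
        = ∑ ω, ∑ ω₂, ∑ ω₁, (if VZ ω₁ = VZ ω then (1 : ℝ) else 0) *
            (if X ω₂ = X ω then (1 : ℝ) else 0) *
            (fiberCard XZ ω)⁻¹ * (fiberCard V ω)⁻¹ := by
          refine Finset.sum_congr rfl fun ω _ => ?_
          rw [fiberCard_eq_sum VZ, fiberCard_eq_sum X, Finset.sum_mul_sum, Finset.sum_comm,
            Finset.sum_mul, Finset.sum_mul]
          exact Finset.sum_congr rfl fun ω₂ _ => by rw [Finset.sum_mul, Finset.sum_mul]
      _ ≤ ∑ ω, ∑ ω₂, ∑ ω₁, (if V ω₁ = V ω₂ then (fiberCard V ω₂)⁻¹ else 0) *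
            (if XZ ω = (X ω₂, Z ω₁) then (fiberCard XZ ω)⁻¹ else 0) := by
          refine Finset.sum_le_sum fun ω _ => Finset.sum_le_sum fun ω₂ _ =>
            Finset.sum_le_sum fun ω₁ _ => ?_
          have hV₂ := inv_nonneg.mpr (fiberCard_pos V ω₂).le
          have hXZ₀ := inv_nonneg.mpr (fiberCard_pos XZ ω).le
          by_cases h₁ : VZ ω₁ = VZ ω
          · by_cases h₂ : X ω₂ = X ω
            · have hV : V ω₂ = V ω := hXV _ _ h₂
              simp only [hVZ, Prod.mk.injEq] at h₁
              have h₃ : V ω₁ = V ω₂ := h₁.1.trans hV.symm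
              have h₄ : XZ ω = (X ω₂, Z ω₁) := by simp [hXZ, h₂, h₁.2]
              rw [if_pos h₂, if_pos h₃, if_pos h₄, fiberCard_congr V hV,
                if_pos (by simp [hVZ, h₁])]
              exact le_of_eq (by ring)
            · rw [if_neg h₂]
              simp only [mul_zero, zero_mul]
              exact mul_nonneg (by split_ifs <;> simp [hV₂]) (by split_ifs <;> simp [hXZ₀])
          · rw [if_neg h₁]
            simp only [zero_mul]
            exact mul_nonneg (by split_ifs <;> simp [hV₂]) (by split_ifs <;> simp [hXZ₀])
      _ = ∑ ω₂, ∑ ω₁, (if V ω₁ = V ω₂ then (fiberCard V ω₂)⁻¹ else 0) *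
            ∑ ω, (if XZ ω = (X ω₂, Z ω₁) then (fiberCard XZ ω)⁻¹ else 0) := by
          rw [Finset.sum_comm]
          refine Finset.sum_congr rfl fun ω₂ _ => ?_
          rw [Finset.sum_comm]
          exact Finset.sum_congr rfl fun ω₁ _ => by rw [Finset.mul_sum]
      _ ≤ ∑ ω₂, ∑ ω₁, (if V ω₁ = V ω₂ then (fiberCard V ω₂)⁻¹ else 0) := by
          refine Finset.sum_le_sum fun ω₂ _ => Finset.sum_le_sum fun ω₁ _ => ?_
          have hV₂ := inv_nonneg.mpr (fiberCard_pos V ω₂).le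
          exact mul_le_of_le_one_right (by split_ifs <;> simp [hV₂])
            (sum_inv_fiberCard_le_one XZ _)
      _ ≤ ∑ _ω₂ : Ω, 1 := by
          refine Finset.sum_le_sum fun ω₂ _ => ?_
          refine le_trans (le_of_eq ?_) (sum_inv_fiberCard_le_one V (V ω₂))
          refine Finset.sum_congr rfl fun ω₁ _ => ?_
          split_ifs with h
          · rw [fiberCard_congr V h]
          · rfl
      _ = Fintype.card Ω := by simp
  have hlog := sum_log_le_zero_of_sum_le_card _ (fun ω => by
    have := fiberCard_pos VZ ω
    have := fiberCard_pos X ω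
    have := fiberCard_pos XZ ω
    have := fiberCard_pos V ω
    positivity) key
  have hsplit : ∀ ω, Real.log (fiberCard VZ ω * fiberCard X ω * (fiberCard XZ ω)⁻¹ *
      (fiberCard V ω)⁻¹) = Real.log (fiberCard VZ ω) + Real.log (fiberCard X ω)
        - Real.log (fiberCard XZ ω) - Real.log (fiberCard V ω) := by
    intro ω
    have h₁ := (fiberCard_pos VZ ω).ne'
    have h₂ := (fiberCard_pos X ω).ne'
    have h₃ := (fiberCard_pos XZ ω).ne'
    have h₄ := (fiberCard_pos V ω).ne'
    rw [Real.log_mul (by positivity) (by positivity), Real.log_mul (by positivity) (by positivity),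
      Real.log_mul h₁ h₂, Real.log_inv, Real.log_inv]
    ring
  simp only [hsplit, Finset.sum_sub_distrib, Finset.sum_add_distrib] at hlog
  unfold logFiberSum
  linarith

/-- The bound `H(V, D) ≤ H(V) + log K` for a variable `D` with `K` values. -/
lemma logFiberSum_le_pair_add (V : Ω → α) [Fintype β] (D : Ω → β) :
    logFiberSum V ≤ logFiberSum (fun ω => (V ω, D ω))
      + Fintype.card Ω * Real.log (Fintype.card β) := by
  rcases isEmpty_or_nonempty Ω with hΩ | ⟨⟨ω₀⟩⟩
  · simp [logFiberSum]
  have hK : (0 : ℝ) < Fintype.card β := by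
    exact_mod_cast Fintype.card_pos_iff.mpr ⟨D ω₀⟩
  set VD : Ω → α × β := fun ω => (V ω, D ω) with hVD
  have key : ∑ ω, fiberCard V ω * (fiberCard VD ω)⁻¹ * (Fintype.card β : ℝ)⁻¹
      ≤ Fintype.card Ω := by
    have hsum : ∑ ω, fiberCard V ω * (fiberCard VD ω)⁻¹
        ≤ (Fintype.card Ω : ℝ) * Fintype.card β := by
      calc ∑ ω, fiberCard V ω * (fiberCard VD ω)⁻¹
          = ∑ ω, ∑ ω₁, ∑ d, (if VD ω = (V ω₁, d) then (fiberCard VD ω)⁻¹ else 0) := by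
            refine Finset.sum_congr rfl fun ω _ => ?_
            rw [fiberCard_eq_sum V, Finset.sum_mul]
            refine Finset.sum_congr rfl fun ω₁ _ => ?_
            by_cases h : V ω₁ = V ω
            · simp [hVD, h]
            · simp [hVD, h, Ne.symm h]
        _ = ∑ ω₁, ∑ d, ∑ ω, (if VD ω = (V ω₁, d) then (fiberCard VD ω)⁻¹ else 0) := by
            rw [Finset.sum_comm]
            exact Finset.sum_congr rfl fun ω₁ _ => Finset.sum_comm
        _ ≤ ∑ _ω₁ : Ω, ∑ _d : β, (1 : ℝ) :=
            Finset.sum_le_sum fun ω₁ _ => Finset.sum_le_sum fun d _ =>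
              sum_inv_fiberCard_le_one VD _
        _ = (Fintype.card Ω : ℝ) * Fintype.card β := by simp
    rw [← Finset.sum_mul]
    exact (mul_inv_le_iff₀ hK).mpr hsum
  have hlog := sum_log_le_zero_of_sum_le_card _ (fun ω => by
    have := fiberCard_pos V ω
    have := fiberCard_pos VD ω
    positivity) key
  have hsplit : ∀ ω, Real.log (fiberCard V ω * (fiberCard VD ω)⁻¹ * (Fintype.card β : ℝ)⁻¹)
      = Real.log (fiberCard V ω) - Real.log (fiberCard VD ω) - Real.log (Fintype.card β) := by
    intro ω
    have h₁ := (fiberCard_pos V ω).ne'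
    have h₂ := (fiberCard_pos VD ω).ne'
    rw [Real.log_mul (by positivity) (by positivity), Real.log_mul h₁ (by positivity),
      Real.log_inv, Real.log_inv]
    ring
  simp only [hsplit, Finset.sum_sub_distrib, Finset.sum_const, Finset.card_univ,
    nsmul_eq_mul] at hlog
  unfold logFiberSum
  linarith

/-- The bound `H(B) ≤ log K` for a variable `B` with `K` values. -/
lemma card_mul_log_card_le [Fintype β] (B : Ω → β) :
    Fintype.card Ω * Real.log (Fintype.card Ω)
      ≤ logFiberSum B + Fintype.card Ω * Real.log (Fintype.card β) := by
  have h := logFiberSum_le_pair_add (fun _ : Ω => ()) B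
  have h' : logFiberSum (fun ω => ((), B ω)) ≤ logFiberSum B :=
    logFiberSum_le_of_determines _ _ fun ω ω' hω => (Prod.mk.inj hω).2
  have h'' : logFiberSum (fun _ : Ω => ())
      = Fintype.card Ω * Real.log (Fintype.card Ω) := by
    simp [logFiberSum, fiberCard]
  linarith

/-- The half of the outer bound obtained by letting user 1 be decoded from the relay signal `B`:
`log |Ω| + H(V) ≤ H(V') + log |δ| + log |β|`. -/
lemma logFiberSum_add_card_mul_log_card_le {δ μ ν : Type*} [Fintype β] [Fintype δ]
    (B : Ω → β) (V : Ω → μ) (V' : Ω → ν) (W : Ω → γ) (D : Ω → δ)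
    (hBV : ∀ ω ω', B ω = B ω' → V ω = V ω')
    (hBW : ∀ ω ω', B ω = B ω' → W ω = W ω' → ω = ω')
    (hVD : ∀ ω ω', V' ω = V' ω' → D ω = D ω' → V ω = V ω' ∧ W ω = W ω') :
    logFiberSum V' + Fintype.card Ω * Real.log (Fintype.card Ω)
      ≤ logFiberSum V + Fintype.card Ω *
        (Real.log (Fintype.card δ) + Real.log (Fintype.card β)) := by
  have h₁ := logFiberSum_le_pair_add V' D
  have h₂ : logFiberSum (fun ω => (V' ω, D ω)) ≤ logFiberSum (fun ω => (V ω, W ω)) :=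
    logFiberSum_le_of_determines _ _ fun ω ω' h => by
      obtain ⟨h₁, h₂⟩ := Prod.mk.inj h
      exact Prod.ext (hVD _ _ h₁ h₂).1 (hVD _ _ h₁ h₂).2
  have h₃ := logFiberSum_submodular B V W hBV
  have h₄ : logFiberSum (fun ω => (B ω, W ω)) = 0 :=
    logFiberSum_of_injective _ fun ω ω' h => by
      obtain ⟨h₁, h₂⟩ := Prod.mk.inj h
      exact hBW _ _ h₁ h₂
  have h₅ := card_mul_log_card_le B
  linarith

end FiberCounting

/-! ### Channel recursions -/

section Channel

lemma srcHist_eq (C : Code n m f nb mb N M1 M2) (w1 : Fin M1) (w2 : Fin M2) (t : ℕ)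
    (s : Fin t) : srcHist C w1 w2 t s = srcXat C w1 w2 s := by
  induction t with
  | zero => exact s.elim0
  | succ t ih =>
    induction s using Fin.lastCases with
    | last => rfl
    | cast s =>
      rw [srcHist, Fin.snoc_castSucc, ih]
      rfl

lemma relayRxAt1_eq (C : Code n m f nb mb N M1 M2) (w1 : Fin M1) (w2 : Fin M2) (t : ℕ) :
    relayRxAt1 C w1 w2 t =
      (shiftMat (max m n) (max m n - n)).mulVec (srcXat C w1 w2 t).1 +
      (shiftMat (max m n) (max m n - m)).mulVec (srcXat C w1 w2 t).2 := rfl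

lemma relayRxAt2_eq (C : Code n m f nb mb N M1 M2) (w1 : Fin M1) (w2 : Fin M2) (t : ℕ) :
    relayRxAt2 C w1 w2 t =
      (shiftMat (max m n) (max m n - m)).mulVec (srcXat C w1 w2 t).1 +
      (shiftMat (max m n) (max m n - n)).mulVec (srcXat C w1 w2 t).2 := rfl

lemma relayTx1_eq (C : Code n m f nb mb N M1 M2) (w1 : Fin M1) (w2 : Fin M2) (t : ℕ)
    (s : Fin t) :
    relayTx1 C (srcHist C w1 w2 t) s =
      C.encR1 s fun u => relayRxAt1 C w1 w2 u := by
  simp only [relayTx1, relayRx1, srcHist_eq, relayRxAt1_eq]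

lemma relayTx2_eq (C : Code n m f nb mb N M1 M2) (w1 : Fin M1) (w2 : Fin M2) (t : ℕ)
    (s : Fin t) :
    relayTx2 C (srcHist C w1 w2 t) s =
      C.encR2 s fun u => relayRxAt2 C w1 w2 u := by
  simp only [relayTx2, relayRx2, srcHist_eq, relayRxAt2_eq]

lemma relayTxAt1_eq (C : Code n m f nb mb N M1 M2) (w1 : Fin M1) (w2 : Fin M2) (t : ℕ) :
    relayTxAt1 C w1 w2 t = C.encR1 t fun u => relayRxAt1 C w1 w2 u :=
  relayTx1_eq C w1 w2 (t + 1) (Fin.last t)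

lemma relayTxAt2_eq (C : Code n m f nb mb N M1 M2) (w1 : Fin M1) (w2 : Fin M2) (t : ℕ) :
    relayTxAt2 C w1 w2 t = C.encR2 t fun u => relayRxAt2 C w1 w2 u :=
  relayTx2_eq C w1 w2 (t + 1) (Fin.last t)

lemma shiftMat_self (q : ℕ) : shiftMat q q = 0 := by
  ext i j
  have := i.isLt
  simp only [shiftMat, Matrix.of_apply, Matrix.zero_apply, ite_eq_right_iff]
  omega

lemma shiftMat_mulVec_add (q k : ℕ) (x : Fin q → ZMod 2) (j : Fin q) (h : j + k < q) :
    (shiftMat q k).mulVec x ⟨j + k, h⟩ = x j := by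
  rw [Matrix.mulVec, dotProduct, Finset.sum_eq_single j]
  · simp [shiftMat]
  · intro b _ hb
    have : ¬ (j : ℕ) = b := fun h => hb (Fin.ext h.symm)
    simp [shiftMat, this]
  · simp

lemma shiftMat_mulVec_of_lt (q k : ℕ) (x : Fin q → ZMod 2) (i : Fin q) (h : (i : ℕ) < k) :
    (shiftMat q k).mulVec x i = 0 := by
  rw [Matrix.mulVec, dotProduct]
  refine Finset.sum_eq_zero fun j _ => ?_
  have : ¬ (i : ℕ) = j + k := by omega
  simp [shiftMat, this]

lemma srcXat_fst_eq (C : Code n m f nb 0 N M1 M2) (w1 : Fin M1) (w2 : Fin M2) (t : ℕ) :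
    (srcXat C w1 w2 t).1 = C.encS1 t w1 fun s =>
      (shiftMat (max 0 (max nb f)) (max 0 (max nb f) - nb)).mulVec (relayTxAt1 C w1 w2 s) := by
  simp only [srcXat, srcHist, Fin.snoc_last]
  congr 1
  funext s
  rw [srcRx1, relayTx1_eq, relayTxAt1_eq, Nat.sub_zero, shiftMat_self, Matrix.zero_mulVec,
    add_zero]

lemma srcXat_snd_eq (C : Code n m f nb 0 N M1 M2) (w1 : Fin M1) (w2 : Fin M2) (t : ℕ) :
    (srcXat C w1 w2 t).2 = C.encS2 t w2 fun s =>
      (shiftMat (max 0 (max nb f)) (max 0 (max nb f) - nb)).mulVec (relayTxAt2 C w1 w2 s) := by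
  simp only [srcXat, srcHist, Fin.snoc_last]
  congr 1
  funext s
  rw [srcRx2, relayTx2_eq, relayTxAt2_eq, Nat.sub_zero, shiftMat_self, Matrix.zero_mulVec,
    add_zero]

/-- The signal `S^{q-n} x ⊕ S^{q-m} y` is determined by `S^{q-m} x` and its own lowest
`max (n - m) m` levels. -/
lemma relay_signal_ext (x y x' y' : FSig n m)
    (hx : (shiftMat (max m n) (max m n - m)).mulVec x =
      (shiftMat (max m n) (max m n - m)).mulVec x')
    (hlow : ∀ i : Fin (max m n), max m n - max (n - m) m ≤ i →
      ((shiftMat (max m n) (max m n - n)).mulVec x +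
        (shiftMat (max m n) (max m n - m)).mulVec y) i =
      ((shiftMat (max m n) (max m n - n)).mulVec x' +
        (shiftMat (max m n) (max m n - m)).mulVec y') i) :
    (shiftMat (max m n) (max m n - n)).mulVec x +
        (shiftMat (max m n) (max m n - m)).mulVec y =
      (shiftMat (max m n) (max m n - n)).mulVec x' +
        (shiftMat (max m n) (max m n - m)).mulVec y' := by
  funext i
  by_cases hi : max m n - max (n - m) m ≤ i
  · exact hlow i hi
  · have hq : max m n - n = 0 := by omega
    have hj : (i : ℕ) + (max m n - m) < max m n := by omega
    have hxi : x i = x' i := by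
      rw [← shiftMat_mulVec_add _ _ x i hj, hx, shiftMat_mulVec_add]
    have hshift : ∀ z : FSig n m, (shiftMat (max m n) (max m n - n)).mulVec z i = z i :=
      fun z => by
        rw [hq]
        exact shiftMat_mulVec_add _ 0 z i i.isLt
    have hlt : (i : ℕ) < max m n - m := by omega
    simp only [Pi.add_apply, hshift, shiftMat_mulVec_of_lt _ _ _ _ hlt, hxi]

/-- The message pairs on which both decoders succeed. -/
abbrev GoodPair (C : Code n m f nb mb N M1 M2) :=
  {w : Fin M1 × Fin M2 // C.dec1 (fun t => destRx1 C w.1 w.2 t.val) = w.1 ∧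
    C.dec2 (fun t => destRx2 C w.1 w.2 t.val) = w.2}

lemma msg1_eq_of_relayTxAt1_eq (C : Code n m f nb mb N M1 M2) (w w' : GoodPair C)
    (h : ∀ t < N, relayTxAt1 C w.1.1 w.1.2 t = relayTxAt1 C w'.1.1 w'.1.2 t) :
    w.1.1 = w'.1.1 := by
  rw [← w.2.1, ← w'.2.1]
  congr 1
  funext t
  rw [destRx1, destRx1, h t t.isLt]

lemma msg2_eq_of_relayTxAt2_eq (C : Code n m f nb mb N M1 M2) (w w' : GoodPair C)
    (h : ∀ t < N, relayTxAt2 C w.1.1 w.1.2 t = relayTxAt2 C w'.1.1 w'.1.2 t) :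
    w.1.2 = w'.1.2 := by
  rw [← w.2.2, ← w'.2.2]
  congr 1
  funext t
  rw [destRx2, destRx2, h t t.isLt]

lemma srcXat_fst_eq_of_relayTxAt1_eq (C : Code n m f nb 0 N M1 M2) (w w' : GoodPair C)
    (h : ∀ t < N, relayTxAt1 C w.1.1 w.1.2 t = relayTxAt1 C w'.1.1 w'.1.2 t)
    (t : ℕ) (ht : t < N) :
    (srcXat C w.1.1 w.1.2 t).1 = (srcXat C w'.1.1 w'.1.2 t).1 := by
  rw [srcXat_fst_eq, srcXat_fst_eq]
  congr 1
  · exact msg1_eq_of_relayTxAt1_eq C w w' h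
  · funext s
    rw [h s (s.isLt.trans ht)]

lemma srcXat_snd_eq_of_relayTxAt2_eq (C : Code n m f nb 0 N M1 M2) (w w' : GoodPair C)
    (h : ∀ t < N, relayTxAt2 C w.1.1 w.1.2 t = relayTxAt2 C w'.1.1 w'.1.2 t)
    (t : ℕ) (ht : t < N) :
    (srcXat C w.1.1 w.1.2 t).2 = (srcXat C w'.1.1 w'.1.2 t).2 := by
  rw [srcXat_snd_eq, srcXat_snd_eq]
  congr 1
  · exact msg2_eq_of_relayTxAt2_eq C w w' h
  · funext s
    rw [h s (s.isLt.trans ht)]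

lemma relayTxAt1_eq_of_relayRxAt1_eq (C : Code n m f nb mb N M1 M2) (w w' : Fin M1 × Fin M2)
    (h : ∀ t < N, relayRxAt1 C w.1 w.2 t = relayRxAt1 C w'.1 w'.2 t) (t : ℕ) (ht : t < N) :
    relayTxAt1 C w.1 w.2 t = relayTxAt1 C w'.1 w'.2 t := by
  rw [relayTxAt1_eq, relayTxAt1_eq]
  congr 1
  funext u
  exact h u (u.isLt.trans ht)

lemma relayTxAt2_eq_of_relayRxAt2_eq (C : Code n m f nb mb N M1 M2) (w w' : Fin M1 × Fin M2)
    (h : ∀ t < N, relayRxAt2 C w.1 w.2 t = relayRxAt2 C w'.1 w'.2 t) (t : ℕ) (ht : t < N) :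
    relayTxAt2 C w.1 w.2 t = relayTxAt2 C w'.1 w'.2 t := by
  rw [relayTxAt2_eq, relayTxAt2_eq]
  congr 1
  funext u
  exact h u (u.isLt.trans ht)

/-- The interference `S^{q-m} x` that a source signal `x` causes at the other relay. -/
def crossSig (x : FSig n m) : FSig n m :=
  (shiftMat (max m n) (max m n - m)).mulVec x

/-- The lowest `max (n - m) m` levels of a first-hop signal. -/
def lowLevels (y : FSig n m) (i : Fin (max (n - m) m)) : ZMod 2 :=
  y ⟨max m n - max (n - m) m + i, by omega⟩

lemma eq_of_lowLevels_eq {y y' : FSig n m} (h : lowLevels y = lowLevels y')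
    (i : Fin (max m n)) (hi : max m n - max (n - m) m ≤ i) : y i = y' i := by
  have := congrFun h ⟨i - (max m n - max (n - m) m), by omega⟩
  simp only [lowLevels] at this
  convert this using 2 <;> exact Fin.ext (by simp; omega)

lemma crossSig_snd_and_msg1_eq (C : Code n m f nb 0 N M1 M2) (w w' : GoodPair C)
    (hV : ∀ t < N, crossSig (srcXat C w.1.1 w.1.2 t).1 = crossSig (srcXat C w'.1.1 w'.1.2 t).1)
    (hD : ∀ t < N, lowLevels (relayRxAt1 C w.1.1 w.1.2 t) =
      lowLevels (relayRxAt1 C w'.1.1 w'.1.2 t)) :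
    (∀ t < N, crossSig (srcXat C w.1.1 w.1.2 t).2 = crossSig (srcXat C w'.1.1 w'.1.2 t).2) ∧
      w.1.1 = w'.1.1 := by
  have hY : ∀ t < N, relayRxAt1 C w.1.1 w.1.2 t = relayRxAt1 C w'.1.1 w'.1.2 t := fun t ht =>
    relay_signal_ext _ _ _ _ (hV t ht) (eq_of_lowLevels_eq (hD t ht))
  have hB := relayTxAt1_eq_of_relayRxAt1_eq C w.1 w'.1 hY
  refine ⟨fun t ht => ?_, msg1_eq_of_relayTxAt1_eq C w w' hB⟩
  have := hY t ht
  rw [relayRxAt1_eq, relayRxAt1_eq, srcXat_fst_eq_of_relayTxAt1_eq C w w' hB t ht] at this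
  exact add_left_cancel this

lemma crossSig_fst_and_msg2_eq (C : Code n m f nb 0 N M1 M2) (w w' : GoodPair C)
    (hV : ∀ t < N, crossSig (srcXat C w.1.1 w.1.2 t).2 = crossSig (srcXat C w'.1.1 w'.1.2 t).2)
    (hD : ∀ t < N, lowLevels (relayRxAt2 C w.1.1 w.1.2 t) =
      lowLevels (relayRxAt2 C w'.1.1 w'.1.2 t)) :
    (∀ t < N, crossSig (srcXat C w.1.1 w.1.2 t).1 = crossSig (srcXat C w'.1.1 w'.1.2 t).1) ∧
      w.1.2 = w'.1.2 := by
  have hY : ∀ t < N, relayRxAt2 C w.1.1 w.1.2 t = relayRxAt2 C w'.1.1 w'.1.2 t := fun t ht => by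
    have hlow := eq_of_lowLevels_eq (hD t ht)
    rw [relayRxAt2_eq, relayRxAt2_eq, add_comm, add_comm (Matrix.mulVec _ (Prod.fst _))]
    refine relay_signal_ext _ _ _ _ (hV t ht) fun i hi => ?_
    have := hlow i hi
    rw [relayRxAt2_eq, relayRxAt2_eq] at this
    simpa only [Pi.add_apply, add_comm] using this
  have hB := relayTxAt2_eq_of_relayRxAt2_eq C w.1 w'.1 hY
  refine ⟨fun t ht => ?_, msg2_eq_of_relayTxAt2_eq C w w' hB⟩
  have := hY t ht
  rw [relayRxAt2_eq, relayRxAt2_eq, srcXat_snd_eq_of_relayTxAt2_eq C w w' hB t ht] at this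
  exact add_right_cancel this

/-- A code with `m̄ = 0` decodes at most `2 ^ (N (max(n - m, m) + max(n̄, f)))` message pairs. -/
lemma log_card_goodPair_le (C : Code n m f nb 0 N M1 M2) [Nonempty (GoodPair C)] :
    Real.log (Fintype.card (GoodPair C)) ≤
      N * ((max (n - m) m : ℕ) + (max nb f : ℕ) : ℝ) * Real.log 2 := by
  let B₁ : GoodPair C → Fin N → BSig f nb 0 := fun w t => relayTxAt1 C w.1.1 w.1.2 t
  let B₂ : GoodPair C → Fin N → BSig f nb 0 := fun w t => relayTxAt2 C w.1.1 w.1.2 t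
  let V₁ : GoodPair C → Fin N → FSig n m := fun w t => crossSig (srcXat C w.1.1 w.1.2 t).1
  let V₂ : GoodPair C → Fin N → FSig n m := fun w t => crossSig (srcXat C w.1.1 w.1.2 t).2
  let D₁ : GoodPair C → Fin N → Fin (max (n - m) m) → ZMod 2 :=
    fun w t => lowLevels (relayRxAt1 C w.1.1 w.1.2 t)
  let D₂ : GoodPair C → Fin N → Fin (max (n - m) m) → ZMod 2 :=
    fun w t => lowLevels (relayRxAt2 C w.1.1 w.1.2 t)
  have unpack : ∀ {α : Type} {g g' : Fin N → α} {p : ℕ → α} {p' : ℕ → α},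
      (∀ t, g t = p t) → (∀ t, g' t = p' t) → g = g' → ∀ t < N, p t = p' t :=
    fun hg hg' h t ht => by rw [← hg ⟨t, ht⟩, ← hg' ⟨t, ht⟩, h]
  have h₁ := logFiberSum_add_card_mul_log_card_le B₁ V₁ V₂ (fun w => w.1.2) D₂
    (fun w w' h => funext fun t => by
      have hB := unpack (fun _ => rfl) (fun _ => rfl) h
      exact congrArg crossSig (srcXat_fst_eq_of_relayTxAt1_eq C w w' hB t t.isLt))
    (fun w w' h hW => Subtype.ext (Prod.ext
      (msg1_eq_of_relayTxAt1_eq C w w' (unpack (fun _ => rfl) (fun _ => rfl) h)) hW))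
    (fun w w' hV hD => by
      have := crossSig_fst_and_msg2_eq C w w' (unpack (fun _ => rfl) (fun _ => rfl) hV)
        (unpack (fun _ => rfl) (fun _ => rfl) hD)
      exact ⟨funext fun t => this.1 t t.isLt, this.2⟩)
  have h₂ := logFiberSum_add_card_mul_log_card_le B₂ V₂ V₁ (fun w => w.1.1) D₁
    (fun w w' h => funext fun t => by
      have hB := unpack (fun _ => rfl) (fun _ => rfl) h
      exact congrArg crossSig (srcXat_snd_eq_of_relayTxAt2_eq C w w' hB t t.isLt))
    (fun w w' h hW => Subtype.ext (Prod.ext hW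
      (msg2_eq_of_relayTxAt2_eq C w w' (unpack (fun _ => rfl) (fun _ => rfl) h))))
    (fun w w' hV hD => by
      have := crossSig_snd_and_msg1_eq C w w' (unpack (fun _ => rfl) (fun _ => rfl) hV)
        (unpack (fun _ => rfl) (fun _ => rfl) hD)
      exact ⟨funext fun t => this.1 t t.isLt, this.2⟩)
  have hδ : Real.log (Fintype.card (Fin N → Fin (max (n - m) m) → ZMod 2))
      = N * ((max (n - m) m : ℕ) : ℝ) * Real.log 2 := by
    rw [Fintype.card_fun, Fintype.card_fun, ZMod.card, Fintype.card_fin, Fintype.card_fin,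
      Nat.cast_pow, Nat.cast_pow, Real.log_pow, Real.log_pow, Nat.cast_ofNat, mul_assoc]
  have hβ : Real.log (Fintype.card (Fin N → BSig f nb 0))
      = N * ((max nb f : ℕ) : ℝ) * Real.log 2 := by
    rw [Fintype.card_fun, Fintype.card_fun, ZMod.card, Fintype.card_fin, Fintype.card_fin,
      Nat.cast_pow, Nat.cast_pow, Real.log_pow, Real.log_pow, Nat.cast_ofNat, mul_assoc,
      max_eq_right (Nat.zero_le _)]
  rw [hδ, hβ] at h₁ h₂
  have hpos : (0 : ℝ) < Fintype.card (GoodPair C) := by exact_mod_cast Fintype.card_pos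
  refine le_of_mul_le_mul_left ?_ hpos
  linarith

lemma one_sub_errProb_mul_eq (C : Code n m f nb mb N M1 M2) (h1 : 0 < M1) (h2 : 0 < M2) :
    (1 - errProb C) * ((M1 : ℝ) * M2) = Fintype.card (GoodPair C) := by
  have hM : (M1 : ℝ) * M2 ≠ 0 := by positivity
  have hcard : Fintype.card (GoodPair C) + (Finset.univ.filter fun w : Fin M1 × Fin M2 =>
      C.dec1 (fun t => destRx1 C w.1 w.2 t.val) ≠ w.1 ∨
      C.dec2 (fun t => destRx2 C w.1 w.2 t.val) ≠ w.2).card = M1 * M2 := by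
    rw [Fintype.card_subtype]
    simp_rw [ne_eq, ← not_and_or]
    rw [Finset.card_filter_add_card_filter_not]
    simp
  have hcast : (Fintype.card (GoodPair C) : ℝ) + ((Finset.univ.filter fun w : Fin M1 × Fin M2 =>
      C.dec1 (fun t => destRx1 C w.1 w.2 t.val) ≠ w.1 ∨
      C.dec2 (fun t => destRx2 C w.1 w.2 t.val) ≠ w.2).card : ℝ) = M1 * M2 := by
    exact_mod_cast hcard
  rw [errProb, sub_mul, one_mul, div_mul_cancel₀ _ hM]
  linarith

lemma sum_rate_le (R1 R2 : ℝ) (h : Achievable n m f nb 0 R1 R2) :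
    R1 + R2 ≤ (max (n - m) m : ℕ) + (max nb f : ℕ) := by
  obtain ⟨-, -, h⟩ := h
  by_contra! hlt
  set K : ℝ := (max (n - m) m : ℕ) + (max nb f : ℕ) with hK
  set δ : ℝ := R1 + R2 - K with hδ
  have hδ0 : 0 < δ := by linarith
  have hη : (2 : ℝ) ^ (-(δ / 2)) < 1 :=
    Real.rpow_lt_one_of_one_lt_of_neg one_lt_two (by linarith)
  have hη0 : 0 < (2 : ℝ) ^ (-(δ / 2)) := by positivity
  obtain ⟨N, hN, C, hC⟩ := h (1 - (2 : ℝ) ^ (-(δ / 2))) (by linarith)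
  have hM : ∀ R : ℝ, 0 < ⌈(2 : ℝ) ^ ((N : ℝ) * R)⌉₊ := fun R =>
    Nat.ceil_pos.mpr (by positivity)
  have hgood := one_sub_errProb_mul_eq C (hM R1) (hM R2)
  have hlow : (2 : ℝ) ^ (-(δ / 2) + N * R1 + N * R2) ≤ Fintype.card (GoodPair C) := by
    rw [← hgood, Real.rpow_add two_pos, Real.rpow_add two_pos, mul_assoc]
    exact mul_le_mul (by linarith)
      (mul_le_mul (Nat.le_ceil _) (Nat.le_ceil _) (by positivity) (by positivity))
      (by positivity) (by linarith)
  have hpos : (0 : ℝ) < (2 : ℝ) ^ (-(δ / 2) + N * R1 + N * R2) := by positivity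
  have : Nonempty (GoodPair C) :=
    Fintype.card_pos_iff.mp (by exact_mod_cast hpos.trans_le hlow)
  have hlog := (Real.log_le_log hpos hlow).trans (log_card_goodPair_le C)
  rw [Real.log_rpow two_pos] at hlog
  have hexp := le_of_mul_le_mul_right hlog (Real.log_pos one_lt_two)
  have hN1 : (1 : ℝ) ≤ N := by exact_mod_cast hN
  have hsum : (N : ℝ) * δ = N * R1 + N * R2 - N * K := by rw [hδ]; ring
  have := mul_le_mul_of_nonneg_right hN1 hδ0.le
  linarith

end Channel

end TwoHopIC

open TwoHopIC in
/-- Outer bound (36) with no backward cross-link: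
`C_sum ≤ f + max(n − m, m) + (n̄ − f)⁺` when `m̄ = 0`. -/
theorem sumCapacity_le_no_crosslink (n m f nb : ℕ) :
    sumCapacity n m f nb 0 ≤
      (f : ℝ) + max ((n : ℝ) - m) m + max ((nb : ℝ) - f) 0 := by
  have hbound : ((max (n - m) m : ℕ) : ℝ) + (max nb f : ℕ) ≤
      (f : ℝ) + max ((n : ℝ) - m) m + max ((nb : ℝ) - f) 0 := by
    have h₁ : ((max (n - m) m : ℕ) : ℝ) ≤ max ((n : ℝ) - m) m := by
      rcases le_total m n with h | h
      · rw [Nat.cast_max, Nat.cast_sub h]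
      · simp [Nat.sub_eq_zero_of_le h]
    have h₂ : ((max nb f : ℕ) : ℝ) = f + max ((nb : ℝ) - f) 0 := by
      rw [← max_add_add_left, add_sub_cancel, add_zero, Nat.cast_max]
    linarith
  refine Real.sSup_le ?_ (le_trans (by positivity) hbound)
  rintro r ⟨R1, R2, h, rfl⟩
  exact (sum_rate_le R1 R2 h).trans hbound
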